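/- Consider the stated primal-dual setting with Z ≠ ∅ and the stated asynchronous block-iterative projective splitting algorithm with its activation, delay, error, and parameter conditions. Then the sequence ((x_{i,n})_{i∈I}, (v_{k,n}*)_{k∈K})_{n∈ℕ} converges weakly to a point in Z. -/

import Mathlib

open Filter Topology RealInnerProductSpace

/-- A set-valued operator `M : H → 2^H` is monotone. -/
def IsMonotoneOp {H : Type*} [NormedAddCommGroup H] [InnerProductSpace ℝ H]
    (M : H → Set H) : Prop :=
  ∀ x y u v, u ∈ M x → v ∈ M y → 0 ≤ ⟪x - y, u - v⟫

/-- A set-valued operator is maximally monotone if it is monotone and its graph is not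
properly contained in the graph of another monotone operator. -/
def IsMaximalMonotone {H : Type*} [NormedAddCommGroup H] [InnerProductSpace ℝ H]
    (M : H → Set H) : Prop :=
  IsMonotoneOp M ∧
    ∀ M' : H → Set H, IsMonotoneOp M' → (∀ x, M x ⊆ M' x) → ∀ x, M' x ⊆ M x


lemma aux_tendsto_zero_of_sq {u : ℕ → ℝ} {l : Filter ℕ}
    (h : Tendsto (fun n => u n ^ 2) l (𝓝 0)) : Tendsto u l (𝓝 0) := by
  have h1 := (Real.continuous_sqrt.tendsto 0).comp h
  simp only [Real.sqrt_zero, Function.comp_def, Real.sqrt_sq_eq_abs] at h1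
  exact (tendsto_zero_iff_abs_tendsto_zero u).2 h1

lemma aux_fejer_scalar (D β π τ θ lam : ℕ → ℝ) (ε : ℝ) (hε : 0 < ε)
    (hlam : ∀ n, lam n ∈ Set.Icc ε (2 - ε))
    (hD : ∀ n, 0 ≤ D n)
    (hstep : ∀ n, D (n + 1) = D n - 2 * (θ n * β n) + θ n ^ 2 * τ n)
    (hβ : ∀ n, π n ≤ β n) (hτ : ∀ n, 0 ≤ τ n) (hτ0 : ∀ n, τ n = 0 → π n ≤ 0)
    (hθpos : ∀ n, 0 < π n → θ n = lam n * π n / τ n)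
    (hθneg : ∀ n, ¬ 0 < π n → θ n = 0) :
    Antitone D ∧ Tendsto (fun n => θ n ^ 2 * τ n) atTop (𝓝 0) ∧
    ∀ C, (∀ n, τ n ≤ C) → Tendsto (fun n => max (π n) 0) atTop (𝓝 0) := by
  have hs0 : ∀ n, 0 ≤ θ n ^ 2 * τ n := fun n => mul_nonneg (sq_nonneg _) (hτ n)
  have key : ∀ n, D (n + 1) ≤ D n - ε / 2 * (θ n ^ 2 * τ n) := by
    intro n
    rw [hstep]
    by_cases hp : 0 < π n
    · have hτp : 0 < τ n := lt_of_le_of_ne (hτ n) (fun h => by linarith [hτ0 n h.symm])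
      have h1 : θ n * τ n = lam n * π n := by
        rw [hθpos n hp]; field_simp
      have hl := hlam n
      have hl0 : 0 < lam n := lt_of_lt_of_le hε hl.1
      have hθ0 : 0 ≤ θ n := by rw [hθpos n hp]; positivity
      have h2 : θ n * π n ≤ θ n * β n := mul_le_mul_of_nonneg_left (hβ n) hθ0
      have h3 : θ n ^ 2 * τ n = lam n * (θ n * π n) := by
        rw [sq, mul_assoc, h1]; ring
      have h4 : 0 ≤ θ n * π n := mul_nonneg hθ0 hp.le
      have h5 : lam n * (θ n * π n) * (1 + ε / 2) ≤ 2 * (θ n * π n) := by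
        have : lam n * (1 + ε / 2) ≤ 2 := by nlinarith [hl.2, hl.1]
        nlinarith
      rw [h3]; linarith
    · rw [hθneg n hp]; simp
  have hanti : Antitone D := antitone_nat_of_succ_le fun n => by
    have := mul_nonneg (half_pos hε).le (hs0 n)
    linarith [key n]
  have hconv := tendsto_atTop_ciInf hanti ⟨0, by rintro _ ⟨n, rfl⟩; exact hD n⟩
  have hdiff : Tendsto (fun n => 2 / ε * (D n - D (n + 1))) atTop (𝓝 0) := by
    have := ((hconv.sub (hconv.comp (tendsto_add_atTop_nat 1))).const_mul (2 / ε))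
    simpa using this
  have hs : Tendsto (fun n => θ n ^ 2 * τ n) atTop (𝓝 0) := by
    refine squeeze_zero hs0 (fun n => ?_) hdiff
    have := key n
    rw [div_mul_eq_mul_div, le_div_iff₀ hε]
    linarith
  refine ⟨hanti, hs, fun C hC => ?_⟩
  apply aux_tendsto_zero_of_sq
  have h0 : Tendsto (fun n => (θ n ^ 2 * τ n) * (C / ε ^ 2)) atTop (𝓝 0) := by
    simpa using hs.mul_const (C / ε ^ 2)
  refine squeeze_zero (fun n => sq_nonneg _) (fun n => ?_) h0
  by_cases hp : 0 < π n
  · rw [max_eq_left hp.le]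
    have hτp : 0 < τ n := lt_of_le_of_ne (hτ n) (fun h => by linarith [hτ0 n h.symm])
    have h1 : θ n * τ n = lam n * π n := by
      rw [hθpos n hp]; field_simp
    have h2 : θ n ^ 2 * τ n * τ n = lam n ^ 2 * π n ^ 2 := by
      rw [← mul_pow, ← h1]; ring
    have h3 : ε ^ 2 * π n ^ 2 ≤ lam n ^ 2 * π n ^ 2 :=
      mul_le_mul_of_nonneg_right (pow_le_pow_left₀ hε.le (hlam n).1 2) (sq_nonneg _)
    have h4 : θ n ^ 2 * τ n * τ n ≤ θ n ^ 2 * τ n * C :=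
      mul_le_mul_of_nonneg_left (hC n) (hs0 n)
    rw [mul_div_assoc', le_div_iff₀ (by positivity)]
    linarith
  · rw [max_eq_right (not_lt.1 hp)]
    have : 0 ≤ C := (hτ n).trans (hC n)
    have := hs0 n
    simp only [ne_eq, OfNat.ofNat_ne_zero, not_false_eq_true, zero_pow]
    positivity

lemma aux_weak_cluster {H : Type*} [NormedAddCommGroup H] [InnerProductSpace ℝ H]
    [CompleteSpace H] (x : ℕ → H) (C : ℝ) (hC : ∀ n, ‖x n‖ ≤ C) (U : Ultrafilter ℕ) :
    ∃ xb : H, ∀ w : H, Tendsto (fun n => ⟪x n, w⟫) U (𝓝 ⟪xb, w⟫) := by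
  have hb : ∀ w n, ⟪x n, w⟫ ∈ Set.Icc (-(C * ‖w‖)) (C * ‖w‖) := by
    intro w n
    exact abs_le.1 <| (abs_real_inner_le_norm _ _).trans
      (mul_le_mul_of_nonneg_right (hC n) (norm_nonneg _))
  have hlim : ∀ w, ∃ y ∈ Set.Icc (-(C * ‖w‖)) (C * ‖w‖),
      Tendsto (fun n => ⟪x n, w⟫) U (𝓝 y) := by
    intro w
    obtain ⟨y, hy, hy'⟩ := (isCompact_Icc (a := -(C * ‖w‖)) (b := C * ‖w‖)).ultrafilter_le_nhds
      (U.map (fun n => ⟪x n, w⟫)) (by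
        rw [Ultrafilter.coe_map, le_principal_iff]
        exact Filter.mem_map.2 (Filter.univ_mem' (hb w)))
    exact ⟨y, hy, hy'⟩
  choose φ hφ hφt using hlim
  let F : H →ₗ[ℝ] ℝ :=
    { toFun := φ
      map_add' := fun u w => by
        refine tendsto_nhds_unique (hφt (u + w)) ?_
        simpa only [inner_add_right] using (hφt u).add (hφt w)
      map_smul' := fun s w => by
        refine tendsto_nhds_unique (hφt (s • w)) ?_
        simpa only [real_inner_smul_right, RingHom.id_apply, smul_eq_mul] using (hφt w).const_mul s }
  let G : H →L[ℝ] ℝ := F.mkContinuous C (fun w => abs_le.2 (hφ w))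
  refine ⟨(InnerProductSpace.toDual ℝ H).symm G, fun w => ?_⟩
  rw [InnerProductSpace.toDual_symm_apply]
  exact hφt w

lemma aux_maxmono {H : Type*} [NormedAddCommGroup H] [InnerProductSpace ℝ H]
    (M : H → Set H) (hM : IsMaximalMonotone M) (x u : H) (hu : u ∉ M x) :
    ∃ y w, w ∈ M y ∧ ⟪x - y, u - w⟫ < 0 := by
  by_contra hcon
  push Not at hcon
  apply hu
  refine hM.2 (fun y => {w | w ∈ M y ∨ (y = x ∧ w = u)}) ?_ ?_ x ?_
  · rintro p q s t (hs | ⟨rfl, rfl⟩) (ht | ⟨rfl, rfl⟩)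
    · exact hM.1 p q s t hs ht
    · rw [← neg_sub q p, ← neg_sub t s, inner_neg_neg]
      exact hcon _ _ hs
    · exact hcon _ _ ht
    · simp
  · intro y w hw; exact Or.inl hw
  · exact Or.inr ⟨rfl, rfl⟩

lemma aux_maxmono' {H : Type*} [NormedAddCommGroup H] [InnerProductSpace ℝ H]
    (M : H → Set H) (hM : IsMaximalMonotone M) (x u : H) :
    ∃ y w, w ∈ M y ∧ ⟪x - y, u - w⟫ ≤ 0 ∧ (u ∉ M x → ⟪x - y, u - w⟫ < 0) := by
  by_cases h : u ∈ M x
  · exact ⟨x, u, h, by simp, fun h' => absurd h h'⟩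
  · obtain ⟨y, w, hw, hlt⟩ := aux_maxmono M hM x u h
    exact ⟨y, w, hw, hlt.le, fun _ => hlt⟩

section
variable {I K : Type*} [Fintype I] [Fintype K]
    {Hs : I → Type*} {Gs : K → Type*}
    [∀ i, NormedAddCommGroup (Hs i)] [∀ i, InnerProductSpace ℝ (Hs i)]
    [∀ i, CompleteSpace (Hs i)]
    [∀ k, NormedAddCommGroup (Gs k)] [∀ k, InnerProductSpace ℝ (Gs k)]
    [∀ k, CompleteSpace (Gs k)]

lemma aux_pair (L : ∀ k i, Hs i →L[ℝ] Gs k) (x : ∀ i, Hs i) (w : ∀ k, Gs k) :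
    ∑ i, ⟪x i, ∑ k, ContinuousLinearMap.adjoint (L k i) (w k)⟫ =
      ∑ k, ⟪∑ i, L k i (x i), w k⟫ := by
  simp only [inner_sum, sum_inner, ContinuousLinearMap.adjoint_inner_right]
  exact Finset.sum_comm

lemma aux_identity (L : ∀ k i, Hs i →L[ℝ] Gs k) (x a as : ∀ i, Hs i) (v b bs : ∀ k, Gs k) :
    ∑ i, (⟪x i, as i + ∑ k, ContinuousLinearMap.adjoint (L k i) (bs k)⟫ - ⟪a i, as i⟫)
      + ∑ k, (⟪b k - ∑ i, L k i (a i), v k⟫ - ⟪b k, bs k⟫)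
    = ∑ i, ⟪x i - a i, as i + ∑ k, ContinuousLinearMap.adjoint (L k i) (v k)⟫
      + ∑ k, ⟪(∑ i, L k i (x i)) - b k, bs k + - v k⟫ := by
  have h1 := aux_pair L x v
  have h2 := aux_pair L x bs
  have h3 := aux_pair L a v
  simp only [inner_add_right, inner_sub_left, inner_neg_right, Finset.sum_add_distrib,
    Finset.sum_sub_distrib, Finset.sum_neg_distrib, h1, h2, h3]
  ring
end

lemma aux_last (In : ℕ → Prop) (h0 : In 0) (T : ℕ)
    (hT : ∀ n, ∃ j, n ≤ j ∧ j ≤ n + T ∧ In j) :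
    ∃ m : ℕ → ℕ, ∀ n, m n ≤ n ∧ n ≤ m n + T ∧ In (m n) ∧ ∀ j, m n < j → j ≤ n → ¬ In j := by
  classical
  refine ⟨fun n => Nat.findGreatest In n, fun n => ⟨Nat.findGreatest_le n, ?_,
    Nat.findGreatest_spec (Nat.zero_le n) h0, fun j h1 h2 => Nat.findGreatest_is_greatest h1 h2⟩⟩
  obtain ⟨j, hj1, hj2, hj3⟩ := hT (n - T)
  by_cases h : n ≤ T
  · omega
  · have : j ≤ Nat.findGreatest In n := Nat.le_findGreatest (by omega) hj3
    show n ≤ Nat.findGreatest In n + T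
    omega

lemma aux_frozen {H : Type*} (In : ℕ → Prop) (a : ℕ → H)
    (hf : ∀ n, ¬ In n → a n = a (n - 1)) (m n : ℕ) (hmn : m ≤ n)
    (h : ∀ j, m < j → j ≤ n → ¬ In j) : a n = a m := by
  induction n, hmn using Nat.le_induction with
  | base => rfl
  | succ n hmn ih =>
    rw [hf (n + 1) (h _ (by omega) le_rfl), Nat.add_sub_cancel]
    exact ih fun j h1 h2 => h j h1 (by omega)

lemma aux_delay {H : Type*} [NormedAddCommGroup H] (X : ℕ → H)
    (hX : Tendsto (fun n => X (n + 1) - X n) atTop (𝓝 0)) (R : ℕ) (j : ℕ → ℕ)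
    (hj : ∀ n, j n ≤ n ∧ n ≤ j n + R) :
    Tendsto (fun n => X n - X (j n)) atTop (𝓝 0) := by
  have hY : ∀ r, Tendsto (fun n => X (n + r) - X n) atTop (𝓝 0) := by
    intro r
    induction r with
    | zero => simp
    | succ r ih =>
      have := (hX.comp (tendsto_add_atTop_nat r)).add ih
      simp only [add_zero] at this
      refine this.congr fun n => ?_
      simp only [Function.comp]
      rw [show n + (r + 1) = n + r + 1 by omega]
      abel
  have hS : Tendsto (fun n => ∑ r ∈ Finset.range (R + 1), ‖X (n + r) - X n‖) atTop (𝓝 0) := by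
    have := tendsto_finsetSum (Finset.range (R + 1)) fun r _ => (hY r).norm
    simpa using this
  have hjt : Tendsto j atTop atTop := by
    refine tendsto_atTop.2 fun b => ?_
    filter_upwards [eventually_ge_atTop (b + R)] with n hn
    have := hj n
    omega
  refine squeeze_zero_norm (fun n => ?_) (hS.comp hjt)
  have h1 := hj n
  have := Finset.single_le_sum (f := fun r => ‖X (j n + r) - X (j n)‖)
    (fun r _ => norm_nonneg _) (Finset.mem_range.2 (show n - j n < R + 1 by omega))
  simpa [Nat.add_sub_cancel' h1.1] using this

/-- Norm-bounded sequences. -/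
def AuxBd {H : Type*} [NormedAddCommGroup H] (u : ℕ → H) : Prop := ∃ C, ∀ n, ‖u n‖ ≤ C

lemma AuxBd.neg {H : Type*} [NormedAddCommGroup H] {u : ℕ → H} (h : AuxBd u) :
    AuxBd (fun n => - u n) := by
  obtain ⟨C, hC⟩ := h
  exact ⟨C, fun n => by simpa using hC n⟩

lemma AuxBd.add {H : Type*} [NormedAddCommGroup H] {u w : ℕ → H} (h : AuxBd u) (h' : AuxBd w) :
    AuxBd (fun n => u n + w n) := by
  obtain ⟨C, hC⟩ := h
  obtain ⟨C', hC'⟩ := h'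
  exact ⟨C + C', fun n => (norm_add_le _ _).trans (add_le_add (hC n) (hC' n))⟩

lemma AuxBd.sub {H : Type*} [NormedAddCommGroup H] {u w : ℕ → H} (h : AuxBd u) (h' : AuxBd w) :
    AuxBd (fun n => u n - w n) := by
  simpa only [sub_eq_add_neg] using h.add h'.neg

lemma AuxBd.sum {ι H : Type*} [NormedAddCommGroup H] {u : ι → ℕ → H} (s : Finset ι)
    (h : ∀ i, AuxBd (u i)) : AuxBd (fun n => ∑ i ∈ s, u i n) := by
  choose C hC using h
  exact ⟨∑ i ∈ s, C i, fun n => (norm_sum_le _ _).trans (Finset.sum_le_sum fun i _ => hC i n)⟩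

lemma AuxBd.map {H G : Type*} [NormedAddCommGroup H] [NormedSpace ℝ H] [NormedAddCommGroup G]
    [NormedSpace ℝ G] {u : ℕ → H} (h : AuxBd u) (L : H →L[ℝ] G) :
    AuxBd (fun n => L (u n)) := by
  obtain ⟨C, hC⟩ := h
  exact ⟨‖L‖ * C, fun n => (L.le_opNorm _).trans
    (mul_le_mul_of_nonneg_left (hC n) (norm_nonneg _))⟩

lemma AuxBd.inner_zero {H : Type*} [NormedAddCommGroup H] [InnerProductSpace ℝ H]
    {u w : ℕ → H} (h : AuxBd u) (hw : Tendsto w atTop (𝓝 0)) :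
    Tendsto (fun n => ⟪u n, w n⟫) atTop (𝓝 0) := by
  obtain ⟨C, hC⟩ := h
  have h1 : Tendsto (fun n => C * ‖w n‖) atTop (𝓝 0) := by
    simpa using hw.norm.const_mul C
  refine squeeze_zero_norm (fun n => ?_) h1
  exact (norm_inner_le_norm _ _).trans (mul_le_mul_of_nonneg_right (hC n) (norm_nonneg _))

section
variable {H : Type*} [NormedAddCommGroup H] [InnerProductSpace ℝ H]

lemma aux_bdd (In : ℕ → Prop) (h0 : In 0) (X V a s e : ℕ → H) (c : ℕ → ℕ) (γ : ℕ → ℝ)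
    (ε : ℝ) (hε : 0 < ε) (hγ : ∀ n, γ n ∈ Set.Icc ε ε⁻¹)
    (hs : ∀ n, In n → s n = (γ (c n))⁻¹ • (X (c n) - a n + e n) - V (c n))
    (hf : ∀ n, ¬ In n → a n = a (n - 1) ∧ s n = s (n - 1))
    (η : ℝ) (he : ∀ n, In n → ‖e n‖ ≤ η) (xb ub : H)
    (hm : ∀ n, In n → 0 ≤ ⟪a n - xb, s n - ub⟫) (hX : AuxBd X) (hV : AuxBd V) :
    AuxBd a ∧ AuxBd s := by
  obtain ⟨C, hC⟩ := hX
  obtain ⟨C', hC'⟩ := hV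
  set R := C + η + ‖xb‖ + ε⁻¹ * (C' + ‖ub‖) with hR
  set R1 := R + ‖xb‖ with hR1
  set R2 := ε⁻¹ * (C + R1 + η) + C' with hR2
  have hact : ∀ n, In n → ‖a n‖ ≤ R1 ∧ ‖s n‖ ≤ R2 := by
    intro n hn
    have hg := hγ (c n)
    have hg0 : 0 < γ (c n) := hε.trans_le hg.1
    have h1 := hm n hn
    have h2 := hs n hn
    have e1 : γ (c n) * ⟪a n - xb, s n - ub⟫ =
        ⟪a n - xb, (X (c n) + e n - xb) - γ (c n) • (V (c n) + ub)⟫ - ‖a n - xb‖ ^ 2 := by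
      rw [← real_inner_smul_right, ← real_inner_self_eq_norm_sq, ← inner_sub_right, h2]
      congr 1
      simp only [smul_sub, smul_add, smul_smul, mul_inv_cancel₀ hg0.ne', one_smul]
      abel
    have h3 : ‖a n - xb‖ ^ 2 ≤ ‖a n - xb‖ * R := by
      have h4 : 0 ≤ γ (c n) * ⟪a n - xb, s n - ub⟫ := mul_nonneg hg0.le h1
      have h5 := real_inner_le_norm (a n - xb)
        ((X (c n) + e n - xb) - γ (c n) • (V (c n) + ub))
      have h6 : ‖(X (c n) + e n - xb) - γ (c n) • (V (c n) + ub)‖ ≤ R := by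
        have i1 := norm_sub_le (X (c n) + e n - xb) (γ (c n) • (V (c n) + ub))
        have i2 := norm_sub_le (X (c n) + e n) xb
        have i3 := norm_add_le (X (c n)) (e n)
        have i4 : ‖γ (c n) • (V (c n) + ub)‖ ≤ ε⁻¹ * (C' + ‖ub‖) := by
          rw [norm_smul, Real.norm_of_nonneg hg0.le]
          exact mul_le_mul hg.2 ((norm_add_le _ _).trans (by linarith [hC' (c n)]))
            (norm_nonneg _) (inv_pos.2 hε).le
        linarith [hC (c n), he n hn]
      have h7 := mul_le_mul_of_nonneg_left h6 (norm_nonneg (a n - xb))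
      linarith
    have hR0 : 0 ≤ R := by
      have i1 := (norm_nonneg _).trans (hC 0)
      have i2 := (norm_nonneg _).trans (hC' 0)
      have i3 := (norm_nonneg _).trans (he n hn)
      positivity
    have h8 : ‖a n - xb‖ ≤ R := by
      by_contra hcon
      push Not at hcon
      nlinarith
    have h9 : ‖a n‖ ≤ R1 := by
      have := norm_add_le (a n - xb) xb
      rw [sub_add_cancel] at this
      linarith
    refine ⟨h9, ?_⟩
    rw [h2]
    refine (norm_sub_le _ _).trans (add_le_add ?_ (hC' _))
    rw [norm_smul, Real.norm_of_nonneg (inv_pos.2 hg0).le]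
    refine mul_le_mul (inv_anti₀ hε hg.1) ?_ (norm_nonneg _) (inv_pos.2 hε).le
    have i1 := norm_add_le (X (c n) - a n) (e n)
    have i2 := norm_sub_le (X (c n)) (a n)
    linarith [hC (c n), he n hn]
  have hall : ∀ n, ‖a n‖ ≤ R1 ∧ ‖s n‖ ≤ R2 := by
    intro n
    induction n with
    | zero => exact hact 0 h0
    | succ n ih =>
      by_cases h : In (n + 1)
      · exact hact _ h
      · rw [(hf _ h).1, (hf _ h).2, Nat.add_sub_cancel]; exact ih
  exact ⟨⟨R1, fun n => (hall n).1⟩, ⟨R2, fun n => (hall n).2⟩⟩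

lemma aux_block (In : ℕ → Prop) (h0 : In 0) (T D : ℕ)
    (hT : ∀ n, ∃ j, n ≤ j ∧ j ≤ n + T ∧ In j)
    (X V a s e : ℕ → H) (c : ℕ → ℕ) (hc : ∀ n, n - D ≤ c n ∧ c n ≤ n) (γ : ℕ → ℝ)
    (ε : ℝ) (hε : 0 < ε) (hγ : ∀ n, γ n ∈ Set.Icc ε ε⁻¹)
    (hs : ∀ n, In n → s n = (γ (c n))⁻¹ • (X (c n) - a n + e n) - V (c n))
    (hf : ∀ n, ¬ In n → a n = a (n - 1) ∧ s n = s (n - 1))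
    (σ : ℝ) (hσ : σ < 1)
    (he1 : ∀ n, In n → -(σ * ‖X (c n) - a n‖ ^ 2) ≤ ⟪X (c n) - a n, e n⟫)
    (he2 : ∀ n, In n → ⟪e n, s n + V (c n)⟫ ≤ σ * γ (c n) * ‖s n + V (c n)‖ ^ 2)
    (hX : AuxBd X) (hV : AuxBd V) (ha : AuxBd a) (hsb : AuxBd s)
    (hX1 : Tendsto (fun n => X (n + 1) - X n) atTop (𝓝 0))
    (hV1 : Tendsto (fun n => V (n + 1) - V n) atTop (𝓝 0)) :
    ∃ q : ℕ → ℝ, (∀ n, 0 ≤ q n) ∧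
      Tendsto (fun n => ⟪X n - a n, s n + V n⟫ - q n) atTop (𝓝 0) ∧
      (Tendsto q atTop (𝓝 0) → Tendsto (fun n => X n - a n) atTop (𝓝 0) ∧
        Tendsto (fun n => s n + V n) atTop (𝓝 0)) := by
  obtain ⟨m, hm⟩ := aux_last In h0 T hT
  set j : ℕ → ℕ := fun n => c (m n) with hj
  have hjn : ∀ n, j n ≤ n ∧ n ≤ j n + (T + D) := by
    intro n
    have h1 := hm n
    have h2 := hc (m n)
    simp only [hj]
    omega
  have hXd := aux_delay X hX1 _ j hjn
  have hVd := aux_delay V hV1 _ j hjn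
  have ham : ∀ n, a n = a (m n) := fun n =>
    aux_frozen In a (fun n h => (hf n h).1) _ _ (hm n).1 (hm n).2.2.2
  have hsm : ∀ n, s n = s (m n) := fun n =>
    aux_frozen In s (fun n h => (hf n h).2) _ _ (hm n).1 (hm n).2.2.2
  set κ := ε * (1 - σ) with hκ
  have hκ0 : 0 < κ := mul_pos hε (by linarith)
  have hact : ∀ n, In n → κ * ‖X (c n) - a n‖ ^ 2 ≤ ⟪X (c n) - a n, s n + V (c n)⟫ ∧
      κ * ‖s n + V (c n)‖ ^ 2 ≤ ⟪X (c n) - a n, s n + V (c n)⟫ := by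
    intro n hn
    have hg := hγ (c n)
    have hg0 : 0 < γ (c n) := hε.trans_le hg.1
    have e0 : s n + V (c n) = (γ (c n))⁻¹ • (X (c n) - a n + e n) := by rw [hs n hn]; abel
    constructor
    · rw [e0, real_inner_smul_right, inner_add_right, real_inner_self_eq_norm_sq]
      have h1 := he1 n hn
      have h2 : ε ≤ (γ (c n))⁻¹ := by
        rw [le_inv_comm₀ hε hg0]; exact hg.2
      have h3 : 0 ≤ (1 - σ) * ‖X (c n) - a n‖ ^ 2 :=
        mul_nonneg (by linarith) (sq_nonneg _)
      calc κ * ‖X (c n) - a n‖ ^ 2 = ε * ((1 - σ) * ‖X (c n) - a n‖ ^ 2) := by rw [hκ]; ring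
        _ ≤ (γ (c n))⁻¹ * ((1 - σ) * ‖X (c n) - a n‖ ^ 2) := mul_le_mul_of_nonneg_right h2 h3
        _ ≤ _ := mul_le_mul_of_nonneg_left (by linarith) (inv_pos.2 hg0).le
    · have e1 : X (c n) - a n = γ (c n) • (s n + V (c n)) - e n := by
        rw [e0, smul_smul, mul_inv_cancel₀ hg0.ne', one_smul]; abel
      rw [e1, inner_sub_left, real_inner_smul_left, real_inner_self_eq_norm_sq]
      have h1 := he2 n hn
      have h3 : 0 ≤ (1 - σ) * ‖s n + V (c n)‖ ^ 2 :=
        mul_nonneg (by linarith) (sq_nonneg _)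
      have h4 := mul_le_mul_of_nonneg_right hg.1 h3
      rw [hκ]
      linarith
  have hq : ∀ n, κ * ‖X (j n) - a n‖ ^ 2 ≤ ⟪X (j n) - a n, s n + V (j n)⟫ ∧
      κ * ‖s n + V (j n)‖ ^ 2 ≤ ⟪X (j n) - a n, s n + V (j n)⟫ := by
    intro n
    rw [ham n, hsm n]
    exact hact _ (hm n).2.2.1
  have hnull : ∀ u : ℕ → H, (∀ n, κ * ‖u n‖ ^ 2 ≤ ⟪X (j n) - a n, s n + V (j n)⟫) →
      Tendsto (fun n => ⟪X (j n) - a n, s n + V (j n)⟫) atTop (𝓝 0) →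
      Tendsto u atTop (𝓝 0) := by
    intro u hu hq0
    rw [tendsto_zero_iff_norm_tendsto_zero]
    apply aux_tendsto_zero_of_sq
    have h1 : Tendsto (fun n => ⟪X (j n) - a n, s n + V (j n)⟫ / κ) atTop (𝓝 0) := by
      simpa using hq0.div_const κ
    refine squeeze_zero (fun n => sq_nonneg _) (fun n => ?_) h1
    rw [le_div_iff₀ hκ0]
    linarith [hu n]
  refine ⟨fun n => ⟪X (j n) - a n, s n + V (j n)⟫, fun n => ?_, ?_, fun hq0 => ⟨?_, ?_⟩⟩
  · exact (mul_nonneg hκ0.le (sq_nonneg _)).trans (hq n).1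
  · have hXj : AuxBd (fun n => X (j n)) := by
      obtain ⟨C, hC⟩ := hX
      exact ⟨C, fun n => hC _⟩
    have h1 := (hsb.add hV).inner_zero hXd
    have h2 := (hXj.sub ha).inner_zero hVd
    have h3 := h1.add h2
    rw [add_zero] at h3
    refine h3.congr fun n => ?_
    rw [real_inner_comm]
    simp only [inner_add_right, inner_sub_left, inner_sub_right]
    ring
  · have := hXd.add (hnull _ (fun n => (hq n).1) hq0)
    simpa using this
  · have := hVd.add (hnull _ (fun n => (hq n).2) hq0)
    rw [add_zero] at this
    refine this.congr fun n => ?_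
    abel

/-- Weak convergence along a filter. -/
def AuxW (U : Filter ℕ) (u : ℕ → H) (l : H) : Prop :=
  ∀ w : H, Tendsto (fun n => ⟪u n, w⟫) U (𝓝 ⟪l, w⟫)

lemma AuxW.add {U : Filter ℕ} {u u' : ℕ → H} {l l' : H} (h : AuxW U u l) (h' : AuxW U u' l') :
    AuxW U (fun n => u n + u' n) (l + l') := fun w => by
  simpa only [inner_add_left] using (h w).add (h' w)

lemma AuxW.sub {U : Filter ℕ} {u u' : ℕ → H} {l l' : H} (h : AuxW U u l) (h' : AuxW U u' l') :
    AuxW U (fun n => u n - u' n) (l - l') := fun w => by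
  simpa only [inner_sub_left] using (h w).sub (h' w)

lemma AuxW.sum {ι : Type*} (s : Finset ι) {U : Filter ℕ} {u : ι → ℕ → H} {l : ι → H}
    (h : ∀ i, AuxW U (u i) (l i)) :
    AuxW U (fun n => ∑ i ∈ s, u i n) (∑ i ∈ s, l i) := fun w => by
  simpa only [sum_inner] using tendsto_finsetSum s fun i _ => h i w

lemma AuxW.of_tendsto {U : Filter ℕ} {u : ℕ → H} {l : H} (h : Tendsto u U (𝓝 l)) :
    AuxW U u l := fun _ => h.inner tendsto_const_nhds

lemma AuxW.map {G : Type*} [NormedAddCommGroup G] [InnerProductSpace ℝ G] [CompleteSpace H]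
    [CompleteSpace G] {U : Filter ℕ} {u : ℕ → H} {l : H} (h : AuxW U u l) (L : H →L[ℝ] G) :
    AuxW U (fun n => L (u n)) (L l) := fun w => by
  simpa only [← ContinuousLinearMap.adjoint_inner_right] using
    h (ContinuousLinearMap.adjoint L w)
end

/-- Corollary 1 (Combettes–Eckstein): under the stated activation, delay, error, and
parameter conditions, the asynchronous block-iterative projective splitting algorithm
produces a sequence `((x_{i,n})_i, (v_{k,n}*)_k)` converging weakly to a point of the
primal-dual solution set `Z`. -/
theorem projective_splitting_weak_convergence
    {I K : Type*} [Fintype I] [Fintype K]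
    (Hs : I → Type*) (Gs : K → Type*)
    [∀ i, NormedAddCommGroup (Hs i)] [∀ i, InnerProductSpace ℝ (Hs i)]
    [∀ i, CompleteSpace (Hs i)]
    [∀ k, NormedAddCommGroup (Gs k)] [∀ k, InnerProductSpace ℝ (Gs k)]
    [∀ k, CompleteSpace (Gs k)]
    (Ai : ∀ i, Hs i → Set (Hs i)) (hAi : ∀ i, IsMaximalMonotone (Ai i))
    (Bk : ∀ k, Gs k → Set (Gs k)) (hBk : ∀ k, IsMaximalMonotone (Bk k))
    (z : ∀ i, Hs i) (r : ∀ k, Gs k)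
    (L : ∀ k i, Hs i →L[ℝ] Gs k)
    (hZ : ∃ (xb : ∀ i, Hs i) (vb : ∀ k, Gs k),
      (∀ i, z i - ∑ k, ContinuousLinearMap.adjoint (L k i) (vb k) ∈ Ai i (xb i)) ∧
      (∀ k, (∑ i, L k i (xb i)) - r k ∈ {g | vb k ∈ Bk k g}))
    (In : ℕ → Set I) (Kn : ℕ → Set K)
    (hInne : ∀ n, (In n).Nonempty) (hKnne : ∀ n, (Kn n).Nonempty)
    (hIn0 : In 0 = Set.univ) (hKn0 : Kn 0 = Set.univ)
    (hT : ∃ T : ℕ, ∀ n, (⋃ j ∈ Set.Icc n (n + T), In j) = Set.univ ∧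
      (⋃ j ∈ Set.Icc n (n + T), Kn j) = Set.univ)
    (D : ℕ) (ε : ℝ) (hε : ε ∈ Set.Ioo (0 : ℝ) 1)
    (lam : ℕ → ℝ) (hlam : ∀ n, lam n ∈ Set.Icc ε (2 - ε))
    (c : I → ℕ → ℕ) (d : K → ℕ → ℕ)
    (hc : ∀ i n, n - D ≤ c i n ∧ c i n ≤ n) (hd : ∀ k n, n - D ≤ d k n ∧ d k n ≤ n)
    (γ : I → ℕ → ℝ) (μ : K → ℕ → ℝ)
    (hγ : ∀ i n, γ i n ∈ Set.Icc ε ε⁻¹) (hμ : ∀ k n, μ k n ∈ Set.Icc ε ε⁻¹)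
    (x e a astar lI tstar : ∀ i, ℕ → Hs i)
    (v f b bstar lK t : ∀ k, ℕ → Gs k)
    (π θ τ : ℕ → ℝ)
    (hlI : ∀ n, ∀ i ∈ In n,
      lI i n = ∑ k, ContinuousLinearMap.adjoint (L k i) (v k (c i n)))
    (ha : ∀ n, ∀ i ∈ In n,
      (γ i (c i n))⁻¹ • (x i (c i n) + γ i (c i n) • (z i - lI i n) + e i n - a i n)
        ∈ Ai i (a i n))
    (hastar : ∀ n, ∀ i ∈ In n,
      astar i n = (γ i (c i n))⁻¹ • (x i (c i n) - a i n + e i n) - lI i n)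
    (hafreeze : ∀ n, ∀ i ∉ In n, a i n = a i (n - 1) ∧ astar i n = astar i (n - 1))
    (hlK : ∀ n, ∀ k ∈ Kn n, lK k n = ∑ i, L k i (x i (d k n)))
    (hb : ∀ n, ∀ k ∈ Kn n,
      (μ k (d k n))⁻¹ • (lK k n + μ k (d k n) • v k (d k n) + f k n - r k - (b k n - r k))
        ∈ Bk k (b k n - r k))
    (hbstar : ∀ n, ∀ k ∈ Kn n,
      bstar k n = v k (d k n) + (μ k (d k n))⁻¹ • (lK k n - b k n + f k n))
    (hbfreeze : ∀ n, ∀ k ∉ Kn n, b k n = b k (n - 1) ∧ bstar k n = bstar k (n - 1))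
    (ht : ∀ n k, t k n = b k n - ∑ i, L k i (a i n))
    (htstar : ∀ n i,
      tstar i n = astar i n + ∑ k, ContinuousLinearMap.adjoint (L k i) (bstar k n))
    (hπ : ∀ n, π n = ∑ i, (⟪x i n, tstar i n⟫ - ⟪a i n, astar i n⟫)
                   + ∑ k, (⟪t k n, v k n⟫ - ⟪b k n, bstar k n⟫))
    (hτ : ∀ n, τ n = ∑ i, ‖tstar i n‖ ^ 2 + ∑ k, ‖t k n‖ ^ 2)
    (hθpos : ∀ n, 0 < π n → θ n = lam n * π n / τ n)
    (hθneg : ∀ n, ¬ 0 < π n → θ n = 0)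
    (hxupd : ∀ n i, x i (n + 1) = x i n - θ n • tstar i n)
    (hvupd : ∀ n k, v k (n + 1) = v k n - θ n • t k n)
    (herr : ∃ η χ : ℝ, 0 < η ∧ 0 < χ ∧ ∃ σ ζ : ℝ,
      σ ∈ Set.Ioo (0 : ℝ) 1 ∧ ζ ∈ Set.Ioo (0 : ℝ) 1 ∧
      (∀ n, ∀ i ∈ In n, ‖e i n‖ ≤ η ∧
        -(σ * ‖x i (c i n) - a i n‖ ^ 2) ≤ ⟪x i (c i n) - a i n, e i n⟫ ∧
        ⟪e i n, astar i n + lI i n⟫ ≤ σ * γ i (c i n) * ‖astar i n + lI i n‖ ^ 2) ∧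
      (∀ n, ∀ k ∈ Kn n, ‖f k n‖ ≤ χ ∧
        -(ζ * ‖lK k n - b k n‖ ^ 2) ≤ ⟪lK k n - b k n, f k n⟫ ∧
        ⟪f k n, bstar k n - v k (d k n)⟫ ≤
          ζ * μ k (d k n) * ‖bstar k n - v k (d k n)‖ ^ 2)) :
    ∃ (xb : ∀ i, Hs i) (vb : ∀ k, Gs k),
      ((∀ i, z i - ∑ k, ContinuousLinearMap.adjoint (L k i) (vb k) ∈ Ai i (xb i)) ∧
       (∀ k, (∑ i, L k i (xb i)) - r k ∈ {g | vb k ∈ Bk k g})) ∧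
      (∀ i, ∀ w : Hs i, Filter.Tendsto (fun n => ⟪x i n, w⟫) Filter.atTop (nhds ⟪xb i, w⟫)) ∧
      (∀ k, ∀ w : Gs k, Filter.Tendsto (fun n => ⟪v k n, w⟫) Filter.atTop (nhds ⟪vb k, w⟫)) := by
  classical
  obtain ⟨T, hT⟩ := hT
  obtain ⟨η, χ, -, -, σ, ζ, hσ, hζ, herrI, herrK⟩ := herr
  have hε0 : 0 < ε := hε.1
  -- graph membership
  have hAg : ∀ i n, astar i n + z i ∈ Ai i (a i n) := by
    intro i
    have hact : ∀ n, i ∈ In n → astar i n + z i ∈ Ai i (a i n) := by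
      intro n hn
      have h1 := ha n i hn
      have hg0 : 0 < γ i (c i n) := hε0.trans_le (hγ i _).1
      convert h1 using 1
      rw [hastar n i hn]
      simp only [smul_sub, smul_add, smul_smul, inv_mul_cancel₀ hg0.ne', one_smul]
      abel
    intro n
    induction n with
    | zero => exact hact 0 (by simp [hIn0])
    | succ n ih =>
      by_cases h : i ∈ In (n + 1)
      · exact hact _ h
      · rw [(hafreeze _ i h).1, (hafreeze _ i h).2, Nat.add_sub_cancel]; exact ih
  have hBg : ∀ k n, bstar k n ∈ Bk k (b k n - r k) := by
    intro k
    have hact : ∀ n, k ∈ Kn n → bstar k n ∈ Bk k (b k n - r k) := by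
      intro n hn
      have h1 := hb n k hn
      have hg0 : 0 < μ k (d k n) := hε0.trans_le (hμ k _).1
      convert h1 using 1
      rw [hbstar n k hn]
      simp only [smul_sub, smul_add, smul_smul, inv_mul_cancel₀ hg0.ne', one_smul]
      abel
    intro n
    induction n with
    | zero => exact hact 0 (by simp [hKn0])
    | succ n ih =>
      by_cases h : k ∈ Kn (n + 1)
      · exact hact _ h
      · rw [(hbfreeze _ k h).1, (hbfreeze _ k h).2, Nat.add_sub_cancel]; exact ih
  -- monotonicity against solutions
  have hmA : ∀ (xb : ∀ i, Hs i) (vb : ∀ k, Gs k),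
      (∀ i, z i - ∑ k, ContinuousLinearMap.adjoint (L k i) (vb k) ∈ Ai i (xb i)) →
      ∀ i n, 0 ≤ ⟪a i n - xb i,
        astar i n - (- ∑ k, ContinuousLinearMap.adjoint (L k i) (vb k))⟫ := by
    intro xb vb h1 i n
    have := (hAi i).1 _ _ _ _ (hAg i n) (h1 i)
    convert this using 2
    abel
  have hmB : ∀ (xb : ∀ i, Hs i) (vb : ∀ k, Gs k),
      (∀ k, (∑ i, L k i (xb i)) - r k ∈ {g | vb k ∈ Bk k g}) →
      ∀ k n, 0 ≤ ⟪b k n - ∑ i, L k i (xb i), bstar k n - vb k⟫ := by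
    intro xb vb h1 k n
    have := (hBk k).1 _ _ _ _ (hBg k n) (h1 k)
    convert this using 2
    abel
  have hτ0 : ∀ n, 0 ≤ τ n := fun n => by
    rw [hτ]
    positivity
  -- Fejer monotonicity
  have hfej : ∀ (xb : ∀ i, Hs i) (vb : ∀ k, Gs k),
      (∀ i, z i - ∑ k, ContinuousLinearMap.adjoint (L k i) (vb k) ∈ Ai i (xb i)) →
      (∀ k, (∑ i, L k i (xb i)) - r k ∈ {g | vb k ∈ Bk k g}) →
      Antitone (fun n => ∑ i, ‖x i n - xb i‖ ^ 2 + ∑ k, ‖v k n - vb k‖ ^ 2) ∧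
      Tendsto (fun n => θ n ^ 2 * τ n) atTop (𝓝 0) ∧
      ∀ C, (∀ n, τ n ≤ C) → Tendsto (fun n => max (π n) 0) atTop (𝓝 0) := by
    intro xb vb hx1 hv1
    have hβ : ∀ n, π n ≤ ∑ i, ⟪x i n - xb i, tstar i n⟫ + ∑ k, ⟪v k n - vb k, t k n⟫ := by
      intro n
      have hid := aux_identity L xb (fun i => a i n) (fun i => astar i n) vb
        (fun k => b k n) (fun k => bstar k n)
      simp only [← htstar, ← ht] at hid
      have hA : ∑ i, ⟪xb i - a i n,
          astar i n + ∑ k, ContinuousLinearMap.adjoint (L k i) (vb k)⟫ ≤ 0 := by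
        refine Finset.sum_nonpos fun i _ => ?_
        have := hmA xb vb hx1 i n
        rw [sub_neg_eq_add, ← neg_sub, inner_neg_left] at this
        linarith
      have hB : ∑ k, ⟪(∑ i, L k i (xb i)) - b k n, bstar k n + - vb k⟫ ≤ 0 := by
        refine Finset.sum_nonpos fun k _ => ?_
        have := hmB xb vb hv1 k n
        rw [← neg_sub (∑ i, L k i (xb i)), inner_neg_left] at this
        rw [← sub_eq_add_neg]
        linarith
      have hc1 : ∑ k, ⟪v k n, t k n⟫ = ∑ k, ⟪t k n, v k n⟫ :=
        Finset.sum_congr rfl fun k _ => real_inner_comm _ _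
      have hc2 : ∑ k, ⟪vb k, t k n⟫ = ∑ k, ⟪t k n, vb k⟫ :=
        Finset.sum_congr rfl fun k _ => real_inner_comm _ _
      rw [hπ]
      simp only [inner_sub_left, Finset.sum_sub_distrib] at hid ⊢
      simp only [inner_sub_left, Finset.sum_sub_distrib] at hA hB
      linarith
    refine aux_fejer_scalar _ _ π τ θ lam ε hε0 hlam (fun n => by positivity) (fun n => ?_) hβ
      hτ0 ?_ hθpos hθneg
    · have e1 : ∀ i, ‖x i (n + 1) - xb i‖ ^ 2 = ‖x i n - xb i‖ ^ 2
          - 2 * (θ n * ⟪x i n - xb i, tstar i n⟫) + θ n ^ 2 * ‖tstar i n‖ ^ 2 := by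
        intro i
        rw [hxupd, sub_right_comm, norm_sub_sq_real, real_inner_smul_right, norm_smul, mul_pow,
          Real.norm_eq_abs, sq_abs]
      have e2 : ∀ k, ‖v k (n + 1) - vb k‖ ^ 2 = ‖v k n - vb k‖ ^ 2
          - 2 * (θ n * ⟪v k n - vb k, t k n⟫) + θ n ^ 2 * ‖t k n‖ ^ 2 := by
        intro k
        rw [hvupd, sub_right_comm, norm_sub_sq_real, real_inner_smul_right, norm_smul, mul_pow,
          Real.norm_eq_abs, sq_abs]
      simp only [e1, e2, hτ, Finset.sum_add_distrib, Finset.sum_sub_distrib, ← Finset.mul_sum]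
      ring
    · intro n hn
      have h1 := hβ n
      rw [hτ] at hn
      have n1 : 0 ≤ ∑ i, ‖tstar i n‖ ^ 2 := by positivity
      have n2 : 0 ≤ ∑ k, ‖t k n‖ ^ 2 := by positivity
      have z1 : ∑ i, ‖tstar i n‖ ^ 2 = 0 := by linarith
      have z2 : ∑ k, ‖t k n‖ ^ 2 = 0 := by linarith
      rw [Finset.sum_eq_zero_iff_of_nonneg (fun _ _ => sq_nonneg _)] at z1 z2
      have z3 : ∀ i, tstar i n = 0 := fun i => by simpa using z1 i (Finset.mem_univ i)
      have z4 : ∀ k, t k n = 0 := fun k => by simpa using z2 k (Finset.mem_univ k)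
      simpa [z3, z4] using h1
  obtain ⟨x0, v0, hx0, hv0⟩ := hZ
  obtain ⟨hanti, hθτ, hmax⟩ := hfej x0 v0 hx0 hv0
  -- boundedness of the iterates
  have hxle : ∀ (i : I) n, ‖tstar i n‖ ^ 2 ≤ τ n := by
    intro i n
    rw [hτ]
    have h1 := Finset.single_le_sum (f := fun i => ‖tstar i n‖ ^ 2)
      (fun _ _ => sq_nonneg _) (Finset.mem_univ i)
    have n2 : 0 ≤ ∑ k, ‖t k n‖ ^ 2 := by positivity
    linarith
  have hvle : ∀ (k : K) n, ‖t k n‖ ^ 2 ≤ τ n := by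
    intro k n
    rw [hτ]
    have h1 := Finset.single_le_sum (f := fun k => ‖t k n‖ ^ 2)
      (fun _ _ => sq_nonneg _) (Finset.mem_univ k)
    have n2 : 0 ≤ ∑ i, ‖tstar i n‖ ^ 2 := by positivity
    linarith
  have hxB : ∀ i, AuxBd (x i) := by
    intro i
    refine ⟨√(∑ i, ‖x i 0 - x0 i‖ ^ 2 + ∑ k, ‖v k 0 - v0 k‖ ^ 2) + ‖x0 i‖, fun n => ?_⟩
    have h0 := hanti (Nat.zero_le n)
    have h1 := Finset.single_le_sum (f := fun i => ‖x i n - x0 i‖ ^ 2)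
      (fun _ _ => sq_nonneg _) (Finset.mem_univ i)
    have n2 : 0 ≤ ∑ k, ‖v k n - v0 k‖ ^ 2 := by positivity
    simp only at h0
    have h2 : ‖x i n - x0 i‖ ≤ √(∑ i, ‖x i 0 - x0 i‖ ^ 2 + ∑ k, ‖v k 0 - v0 k‖ ^ 2) :=
      Real.le_sqrt_of_sq_le (by linarith)
    have h3 := norm_add_le (x i n - x0 i) (x0 i)
    rw [sub_add_cancel] at h3
    linarith
  have hvB : ∀ k, AuxBd (v k) := by
    intro k
    refine ⟨√(∑ i, ‖x i 0 - x0 i‖ ^ 2 + ∑ k, ‖v k 0 - v0 k‖ ^ 2) + ‖v0 k‖, fun n => ?_⟩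
    have h0 := hanti (Nat.zero_le n)
    have h1 := Finset.single_le_sum (f := fun k => ‖v k n - v0 k‖ ^ 2)
      (fun _ _ => sq_nonneg _) (Finset.mem_univ k)
    have n2 : 0 ≤ ∑ i, ‖x i n - x0 i‖ ^ 2 := by positivity
    simp only at h0
    have h2 : ‖v k n - v0 k‖ ≤ √(∑ i, ‖x i 0 - x0 i‖ ^ 2 + ∑ k, ‖v k 0 - v0 k‖ ^ 2) :=
      Real.le_sqrt_of_sq_le (by linarith)
    have h3 := norm_add_le (v k n - v0 k) (v0 k)
    rw [sub_add_cancel] at h3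
    linarith
  have hx1 : ∀ i, Tendsto (fun n => x i (n + 1) - x i n) atTop (𝓝 0) := by
    intro i
    rw [tendsto_zero_iff_norm_tendsto_zero]
    apply aux_tendsto_zero_of_sq
    refine squeeze_zero (fun n => sq_nonneg _) (fun n => ?_) hθτ
    rw [hxupd, sub_sub_cancel_left, norm_neg, norm_smul, mul_pow, Real.norm_eq_abs, sq_abs]
    exact mul_le_mul_of_nonneg_left (hxle i n) (sq_nonneg _)
  have hv1 : ∀ k, Tendsto (fun n => v k (n + 1) - v k n) atTop (𝓝 0) := by
    intro k
    rw [tendsto_zero_iff_norm_tendsto_zero]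
    apply aux_tendsto_zero_of_sq
    refine squeeze_zero (fun n => sq_nonneg _) (fun n => ?_) hθτ
    rw [hvupd, sub_sub_cancel_left, norm_neg, norm_smul, mul_pow, Real.norm_eq_abs, sq_abs]
    exact mul_le_mul_of_nonneg_left (hvle k n) (sq_nonneg _)
  -- sums of images of null sequences are null
  have hsumL : ∀ (u : ∀ i, ℕ → Hs i), (∀ i, Tendsto (u i) atTop (𝓝 0)) → ∀ k,
      Tendsto (fun n => ∑ i, L k i (u i n)) atTop (𝓝 0) := by
    intro u hu k
    have := tendsto_finsetSum (Finset.univ : Finset I)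
      fun i _ => ((L k i).continuous.tendsto 0).comp (hu i)
    simpa [Function.comp_def] using this
  have hsumLs : ∀ (u : ∀ k, ℕ → Gs k), (∀ k, Tendsto (u k) atTop (𝓝 0)) → ∀ i,
      Tendsto (fun n => ∑ k, ContinuousLinearMap.adjoint (L k i) (u k n)) atTop (𝓝 0) := by
    intro u hu i
    have := tendsto_finsetSum (Finset.univ : Finset K)
      fun k _ => ((ContinuousLinearMap.adjoint (L k i)).continuous.tendsto 0).comp (hu k)
    simpa [Function.comp_def] using this
  -- auxiliary sequences
  let VI : ∀ i, ℕ → Hs i := fun i n => ∑ k, ContinuousLinearMap.adjoint (L k i) (v k n)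
  let XK : ∀ k, ℕ → Gs k := fun k n => ∑ i, L k i (x i n)
  have hVIB : ∀ i, AuxBd (VI i) := fun i => AuxBd.sum _ fun k => (hvB k).map _
  have hXKB : ∀ k, AuxBd (XK k) := fun k => AuxBd.sum _ fun i => (hxB i).map _
  have hVI1 : ∀ i, Tendsto (fun n => VI i (n + 1) - VI i n) atTop (𝓝 0) := by
    intro i
    refine (hsumLs _ hv1 i).congr fun n => ?_
    simp only [VI, map_sub, Finset.sum_sub_distrib]
  have hXK1 : ∀ k, Tendsto (fun n => XK k (n + 1) - XK k n) atTop (𝓝 0) := by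
    intro k
    refine (hsumL _ hx1 k).congr fun n => ?_
    simp only [XK, map_sub, Finset.sum_sub_distrib]
  have hvn1 : ∀ k, Tendsto (fun n => - v k (n + 1) - - v k n) atTop (𝓝 0) := by
    intro k
    have := (hv1 k).neg
    rw [neg_zero] at this
    refine this.congr fun n => ?_
    abel
  have hsI : ∀ i n, i ∈ In n →
      astar i n = (γ i (c i n))⁻¹ • (x i (c i n) - a i n + e i n) - VI i (c i n) := by
    intro i n hn
    rw [hastar n i hn, hlI n i hn]
  have hsK : ∀ k n, k ∈ Kn n →
      bstar k n = (μ k (d k n))⁻¹ • (XK k (d k n) - b k n + f k n) - - v k (d k n) := by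
    intro k n hn
    rw [hbstar n k hn, hlK n k hn]
    abel
  have hI0 : ∀ i, i ∈ In 0 := fun i => by simp [hIn0]
  have hK0 : ∀ k, k ∈ Kn 0 := fun k => by simp [hKn0]
  have hTI : ∀ i n, ∃ j, n ≤ j ∧ j ≤ n + T ∧ i ∈ In j := by
    intro i n
    have : i ∈ ⋃ j ∈ Set.Icc n (n + T), In j := by rw [(hT n).1]; trivial
    simp only [Set.mem_iUnion, Set.mem_Icc] at this
    obtain ⟨j, hj, hj'⟩ := this
    exact ⟨j, hj.1, hj.2, hj'⟩
  have hTK : ∀ k n, ∃ j, n ≤ j ∧ j ≤ n + T ∧ k ∈ Kn j := by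
    intro k n
    have : k ∈ ⋃ j ∈ Set.Icc n (n + T), Kn j := by rw [(hT n).2]; trivial
    simp only [Set.mem_iUnion, Set.mem_Icc] at this
    obtain ⟨j, hj, hj'⟩ := this
    exact ⟨j, hj.1, hj.2, hj'⟩
  have hBI : ∀ i, AuxBd (a i) ∧ AuxBd (astar i) := fun i =>
    aux_bdd (fun n => i ∈ In n) (hI0 i) (x i) (VI i) (a i) (astar i) (e i) (c i) (γ i) ε hε0
      (hγ i) (hsI i) (fun n h => hafreeze n i h) η (fun n h => (herrI n i h).1) (x0 i) _
      (fun n _ => hmA x0 v0 hx0 i n) (hxB i) (hVIB i)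
  have hBK : ∀ k, AuxBd (b k) ∧ AuxBd (bstar k) := fun k =>
    aux_bdd (fun n => k ∈ Kn n) (hK0 k) (XK k) (fun n => - v k n) (b k) (bstar k) (f k) (d k)
      (μ k) ε hε0
      (hμ k) (hsK k) (fun n h => hbfreeze n k h) χ (fun n h => (herrK n k h).1) _ _
      (fun n _ => hmB x0 v0 hv0 k n) (hXKB k) (hvB k).neg
  have hblI : ∀ i, ∃ q : ℕ → ℝ, (∀ n, 0 ≤ q n) ∧
      Tendsto (fun n => ⟪x i n - a i n, astar i n + VI i n⟫ - q n) atTop (𝓝 0) ∧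
      (Tendsto q atTop (𝓝 0) → Tendsto (fun n => x i n - a i n) atTop (𝓝 0) ∧
        Tendsto (fun n => astar i n + VI i n) atTop (𝓝 0)) := by
    intro i
    refine aux_block (fun n => i ∈ In n) (hI0 i) T D (hTI i) (x i) (VI i) (a i) (astar i) (e i)
      (c i) (hc i) (γ i) ε hε0 (hγ i) (hsI i) (fun n h => hafreeze n i h) σ hσ.2
      (fun n h => (herrI n i h).2.1) (fun n h => ?_) (hxB i) (hVIB i) (hBI i).1 (hBI i).2
      (hx1 i) (hVI1 i)
    have := (herrI n i h).2.2
    rw [hlI n i h] at this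
    exact this
  have hblK : ∀ k, ∃ q : ℕ → ℝ, (∀ n, 0 ≤ q n) ∧
      Tendsto (fun n => ⟪XK k n - b k n, bstar k n + - v k n⟫ - q n) atTop (𝓝 0) ∧
      (Tendsto q atTop (𝓝 0) → Tendsto (fun n => XK k n - b k n) atTop (𝓝 0) ∧
        Tendsto (fun n => bstar k n + - v k n) atTop (𝓝 0)) := by
    intro k
    refine aux_block (fun n => k ∈ Kn n) (hK0 k) T D (hTK k) (XK k) (fun n => - v k n) (b k)
      (bstar k) (f k)
      (d k) (hd k) (μ k) ε hε0 (hμ k) (hsK k) (fun n h => hbfreeze n k h) ζ hζ.2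
      (fun n h => ?_) (fun n h => ?_) (hXKB k) (hvB k).neg (hBK k).1 (hBK k).2
      (hXK1 k) (hvn1 k)
    · have := (herrK n k h).2.1
      rw [hlK n k h] at this
      exact this
    · have := (herrK n k h).2.2
      rw [sub_eq_add_neg] at this
      exact this
  choose qI hqI0 hqI hqI' using hblI
  choose qK hqK0 hqK hqK' using hblK
  -- τ bounded
  have htsB : ∀ i, AuxBd (tstar i) := by
    intro i
    have := (hBI i).2.add (AuxBd.sum Finset.univ fun k =>
      (hBK k).2.map (ContinuousLinearMap.adjoint (L k i)))
    simpa only [← htstar] using this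
  have htB : ∀ k, AuxBd (t k) := by
    intro k
    have := (hBK k).1.sub (AuxBd.sum Finset.univ fun i => (hBI i).1.map (L k i))
    simpa only [← ht] using this
  have hτB : ∃ C, ∀ n, τ n ≤ C := by
    choose C hC using htsB
    choose C' hC' using htB
    refine ⟨∑ i, C i ^ 2 + ∑ k, C' k ^ 2, fun n => ?_⟩
    rw [hτ]
    exact add_le_add
      (Finset.sum_le_sum fun i _ => pow_le_pow_left₀ (norm_nonneg _) (hC i n) 2)
      (Finset.sum_le_sum fun k _ => pow_le_pow_left₀ (norm_nonneg _) (hC' k n) 2)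
  obtain ⟨Cτ, hCτ⟩ := hτB
  have hmax0 := hmax Cτ hCτ
  have hπ' : ∀ n, π n = ∑ i, ⟪x i n - a i n, astar i n + VI i n⟫
      + ∑ k, ⟪XK k n - b k n, bstar k n + - v k n⟫ := by
    intro n
    have hid := aux_identity L (fun i => x i n) (fun i => a i n) (fun i => astar i n)
      (fun k => v k n) (fun k => b k n) (fun k => bstar k n)
    simp only [← htstar, ← ht] at hid
    rw [hπ, hid]
  have hδ : Tendsto (fun n => π n - (∑ i, qI i n + ∑ k, qK k n)) atTop (𝓝 0) := by
    have h1 := tendsto_finsetSum (Finset.univ : Finset I) fun i _ => hqI i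
    have h2 := tendsto_finsetSum (Finset.univ : Finset K) fun k _ => hqK k
    have h3 := h1.add h2
    simp only [Finset.sum_const_zero, add_zero] at h3
    refine h3.congr fun n => ?_
    rw [hπ']
    simp only [Finset.sum_sub_distrib]
    ring
  have hS0 : Tendsto (fun n => ∑ i, qI i n + ∑ k, qK k n) atTop (𝓝 0) := by
    have h1 := hmax0.sub hδ
    rw [sub_zero] at h1
    refine squeeze_zero (fun n => ?_) (fun n => ?_) h1
    · exact add_nonneg (Finset.sum_nonneg fun i _ => hqI0 i n)
        (Finset.sum_nonneg fun k _ => hqK0 k n)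
    · linarith [le_max_left (π n) 0]
  have hπ0 : Tendsto π atTop (𝓝 0) := by
    have := hδ.add hS0
    simpa using this
  have hqIt : ∀ i, Tendsto (qI i) atTop (𝓝 0) := by
    intro i
    refine squeeze_zero (hqI0 i) (fun n => ?_) hS0
    have h1 := Finset.single_le_sum (f := fun i => qI i n)
      (fun i _ => hqI0 i n) (Finset.mem_univ i)
    have h2 := Finset.sum_nonneg (s := Finset.univ) fun k _ => hqK0 k n
    linarith
  have hqKt : ∀ k, Tendsto (qK k) atTop (𝓝 0) := by
    intro k
    refine squeeze_zero (hqK0 k) (fun n => ?_) hS0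
    have h1 := Finset.single_le_sum (f := fun k => qK k n)
      (fun k _ => hqK0 k n) (Finset.mem_univ k)
    have h2 := Finset.sum_nonneg (s := Finset.univ) fun i _ => hqI0 i n
    linarith
  have hxa : ∀ i, Tendsto (fun n => x i n - a i n) atTop (𝓝 0) := fun i => (hqI' i (hqIt i)).1
  have hav : ∀ i, Tendsto (fun n => astar i n + VI i n) atTop (𝓝 0) :=
    fun i => (hqI' i (hqIt i)).2
  have hxb : ∀ k, Tendsto (fun n => XK k n - b k n) atTop (𝓝 0) := fun k => (hqK' k (hqKt k)).1
  have hbv : ∀ k, Tendsto (fun n => bstar k n + - v k n) atTop (𝓝 0) :=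
    fun k => (hqK' k (hqKt k)).2
  have hts0 : ∀ i, Tendsto (tstar i) atTop (𝓝 0) := by
    intro i
    have h1 := (hav i).add (hsumLs _ hbv i)
    rw [add_zero] at h1
    refine h1.congr fun n => ?_
    rw [htstar]
    simp only [VI, map_add, map_neg, Finset.sum_add_distrib, Finset.sum_neg_distrib]
    abel
  have ht0 : ∀ k, Tendsto (t k) atTop (𝓝 0) := by
    intro k
    have h1 := (hsumL _ hxa k).sub (hxb k)
    rw [sub_zero] at h1
    refine h1.congr fun n => ?_
    rw [ht]
    simp only [XK, map_sub, Finset.sum_sub_distrib]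
    abel
  have hη0 : Tendsto (fun n => ∑ i, ⟪a i n, astar i n⟫ + ∑ k, ⟪b k n, bstar k n⟫)
      atTop (𝓝 0) := by
    have h1 := tendsto_finsetSum (Finset.univ : Finset I) fun i _ => (hxB i).inner_zero (hts0 i)
    have h2 := tendsto_finsetSum (Finset.univ : Finset K) fun k _ => (hvB k).inner_zero (ht0 k)
    have h3 := (h1.add h2).sub hπ0
    simp only [Finset.sum_const_zero, add_zero, sub_zero] at h3
    refine h3.congr fun n => ?_
    have hc1 : ∑ k, ⟪v k n, t k n⟫ = ∑ k, ⟪t k n, v k n⟫ :=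
      Finset.sum_congr rfl fun k _ => real_inner_comm _ _
    rw [hπ, hc1]
    simp only [Finset.sum_sub_distrib]
    ring
  -- weak cluster points are solutions
  have hclus : ∀ U : Ultrafilter ℕ, (U : Filter ℕ) ≤ atTop → ∀ (xb : ∀ i, Hs i) (vb : ∀ k, Gs k),
      (∀ i, AuxW U (x i) (xb i)) → (∀ k, AuxW U (v k) (vb k)) →
      (∀ i, z i - ∑ k, ContinuousLinearMap.adjoint (L k i) (vb k) ∈ Ai i (xb i)) ∧
      (∀ k, (∑ i, L k i (xb i)) - r k ∈ {g | vb k ∈ Bk k g}) := by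
    intro U hU xb vb hxw hvw
    have wa : ∀ i, AuxW U (a i) (xb i) := by
      intro i
      have := (hxw i).sub (AuxW.of_tendsto ((hxa i).mono_left hU))
      simpa using this
    have was : ∀ i, AuxW U (astar i)
        (0 - ∑ k, ContinuousLinearMap.adjoint (L k i) (vb k)) := by
      intro i
      have h1 : AuxW U (VI i) (∑ k, ContinuousLinearMap.adjoint (L k i) (vb k)) :=
        AuxW.sum _ fun k => (hvw k).map _
      have := (AuxW.of_tendsto ((hav i).mono_left hU)).sub h1
      simpa only [add_sub_cancel_right] using this
    have wb : ∀ k, AuxW U (b k) (∑ i, L k i (xb i)) := by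
      intro k
      have h1 : AuxW U (XK k) (∑ i, L k i (xb i)) := AuxW.sum _ fun i => (hxw i).map _
      have := h1.sub (AuxW.of_tendsto ((hxb k).mono_left hU))
      simpa using this
    have wbs : ∀ k, AuxW U (bstar k) (vb k) := by
      intro k
      have := (AuxW.of_tendsto ((hbv k).mono_left hU)).add (hvw k)
      simpa using this
    have hmmA := fun i => aux_maxmono' (Ai i) (hAi i) (xb i)
      (z i - ∑ k, ContinuousLinearMap.adjoint (L k i) (vb k))
    have hmmB := fun k => aux_maxmono' (Bk k) (hBk k) ((∑ i, L k i (xb i)) - r k) (vb k)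
    choose y w hw hle hlt using hmmA
    choose y' w' hw' hle' hlt' using hmmB
    have hnn : ∀ n, 0 ≤ (∑ i, ⟪a i n, astar i n⟫ + ∑ k, ⟪b k n, bstar k n⟫)
        + (∑ i, (⟪a i n, z i - w i⟫ - ⟪astar i n, y i⟫ - ⟪y i, z i - w i⟫)
        + ∑ k, (⟪r k + y' k, w' k⟫ - ⟪b k n, w' k⟫ - ⟪bstar k n, r k + y' k⟫)) := by
      intro n
      have h1 : 0 ≤ ∑ i, ⟪a i n - y i, astar i n + z i - w i⟫ :=
        Finset.sum_nonneg fun i _ => (hAi i).1 _ _ _ _ (hAg i n) (hw i)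
      have h2 : 0 ≤ ∑ k, ⟪b k n - r k - y' k, bstar k n - w' k⟫ :=
        Finset.sum_nonneg fun k _ => (hBk k).1 _ _ _ _ (hBg k n) (hw' k)
      have e1 : ∑ i, ⟪a i n - y i, astar i n + z i - w i⟫ = ∑ i, ⟪a i n, astar i n⟫ +
          ∑ i, (⟪a i n, z i - w i⟫ - ⟪astar i n, y i⟫ - ⟪y i, z i - w i⟫) := by
        rw [← Finset.sum_add_distrib]
        refine Finset.sum_congr rfl fun i _ => ?_
        rw [real_inner_comm (y i) (astar i n)]
        simp only [inner_sub_left, inner_sub_right, inner_add_right]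
        ring
      have e2 : ∑ k, ⟪b k n - r k - y' k, bstar k n - w' k⟫ = ∑ k, ⟪b k n, bstar k n⟫ +
          ∑ k, (⟪r k + y' k, w' k⟫ - ⟪b k n, w' k⟫ - ⟪bstar k n, r k + y' k⟫) := by
        rw [← Finset.sum_add_distrib]
        refine Finset.sum_congr rfl fun k _ => ?_
        rw [real_inner_comm (r k + y' k) (bstar k n)]
        simp only [inner_sub_left, inner_sub_right, inner_add_left]
        ring
      linarith
    have hlim1 := tendsto_finsetSum (Finset.univ : Finset I) fun i _ =>
      ((wa i (z i - w i)).sub (was i (y i))).sub_const ⟪y i, z i - w i⟫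
    have hlim2 := tendsto_finsetSum (Finset.univ : Finset K) fun k _ =>
      ((wb k (w' k)).const_sub ⟪r k + y' k, w' k⟫).sub (wbs k (r k + y' k))
    have hlim := ge_of_tendsto' ((hη0.mono_left hU).add (hlim1.add hlim2)) hnn
    have hfin : 0 ≤ ∑ i, ⟪xb i - y i,
          z i - ∑ k, ContinuousLinearMap.adjoint (L k i) (vb k) - w i⟫
        + ∑ k, ⟪(∑ i, L k i (xb i)) - r k - y' k, vb k - w' k⟫ := by
      refine hlim.trans (le_of_eq ?_)
      have hp := aux_pair L xb vb
      have e1 : ∀ i, ⟪xb i - y i,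
          z i - ∑ k, ContinuousLinearMap.adjoint (L k i) (vb k) - w i⟫ =
          (⟪xb i, z i - w i⟫ - ⟪0 - ∑ k, ContinuousLinearMap.adjoint (L k i) (vb k), y i⟫
            - ⟪y i, z i - w i⟫)
          - ⟪xb i, ∑ k, ContinuousLinearMap.adjoint (L k i) (vb k)⟫ := by
        intro i
        rw [real_inner_comm (y i) (0 - _)]
        simp only [inner_sub_left, inner_sub_right, inner_zero_right]
        ring
      have e2 : ∀ k, ⟪(∑ i, L k i (xb i)) - r k - y' k, vb k - w' k⟫ =
          (⟪r k + y' k, w' k⟫ - ⟪∑ i, L k i (xb i), w' k⟫ - ⟪vb k, r k + y' k⟫)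
          + ⟪∑ i, L k i (xb i), vb k⟫ := by
        intro k
        rw [real_inner_comm (r k + y' k) (vb k)]
        simp only [inner_sub_left, inner_sub_right, inner_add_left]
        ring
      rw [Finset.sum_congr rfl fun i _ => e1 i, Finset.sum_congr rfl fun k _ => e2 k,
        Finset.sum_add_distrib (f := fun k => ⟪r k + y' k, w' k⟫ - ⟪∑ i, L k i (xb i), w' k⟫
          - ⟪vb k, r k + y' k⟫), ← hp]
      simp only [Finset.sum_sub_distrib]
      ring
    have hA0 := Finset.sum_nonpos (s := Finset.univ) fun i _ => hle i
    have hB0 := Finset.sum_nonpos (s := Finset.univ) fun k _ => hle' k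
    constructor
    · intro i
      by_contra hcon
      have := Finset.sum_lt_sum (s := Finset.univ) (fun i _ => hle i)
        ⟨i, Finset.mem_univ i, hlt i hcon⟩
      rw [Finset.sum_const_zero] at this
      linarith
    · intro k
      by_contra hcon
      have := Finset.sum_lt_sum (s := Finset.univ) (fun k _ => hle' k)
        ⟨k, Finset.mem_univ k, hlt' k hcon⟩
      rw [Finset.sum_const_zero] at this
      linarith
  -- existence of weak cluster points
  have hex : ∀ U : Ultrafilter ℕ, ∃ (xb : ∀ i, Hs i) (vb : ∀ k, Gs k),
      (∀ i, AuxW U (x i) (xb i)) ∧ (∀ k, AuxW U (v k) (vb k)) := by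
    intro U
    have h1 : ∀ i, ∃ y, AuxW U (x i) y := fun i => by
      obtain ⟨C, hC⟩ := hxB i
      exact aux_weak_cluster (x i) C hC U
    have h2 : ∀ k, ∃ y, AuxW U (v k) y := fun k => by
      obtain ⟨C, hC⟩ := hvB k
      exact aux_weak_cluster (v k) C hC U
    choose xb hxb using h1
    choose vb hvb using h2
    exact ⟨xb, vb, hxb, hvb⟩
  -- Opial argument
  have hopial : ∀ U V : Ultrafilter ℕ, (U : Filter ℕ) ≤ atTop → (V : Filter ℕ) ≤ atTop →
      ∀ (xb xb' : ∀ i, Hs i) (vb vb' : ∀ k, Gs k),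
      (∀ i, AuxW U (x i) (xb i)) → (∀ k, AuxW U (v k) (vb k)) →
      (∀ i, AuxW V (x i) (xb' i)) → (∀ k, AuxW V (v k) (vb' k)) →
      (∀ i, xb i = xb' i) ∧ (∀ k, vb k = vb' k) := by
    intro U V hU hV xb xb' vb vb' hx hv hx' hv'
    obtain ⟨hz1, hz2⟩ := hclus U hU xb vb hx hv
    obtain ⟨hz1', hz2'⟩ := hclus V hV xb' vb' hx' hv'
    have c1 := tendsto_atTop_ciInf (hfej xb vb hz1 hz2).1
      ⟨0, by rintro _ ⟨n, rfl⟩; positivity⟩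
    have c2 := tendsto_atTop_ciInf (hfej xb' vb' hz1' hz2').1
      ⟨0, by rintro _ ⟨n, rfl⟩; positivity⟩
    obtain ⟨ℓ, hℓ⟩ : ∃ ℓ, Tendsto (fun n => ∑ i, ⟪x i n, xb i - xb' i⟫
        + ∑ k, ⟪v k n, vb k - vb' k⟫) atTop (𝓝 ℓ) := by
      have c3 := ((c2.sub c1).add_const ((∑ i, ‖xb i‖ ^ 2 + ∑ k, ‖vb k‖ ^ 2)
        - (∑ i, ‖xb' i‖ ^ 2 + ∑ k, ‖vb' k‖ ^ 2))).div_const 2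
      refine ⟨_, c3.congr fun n => ?_⟩
      simp only [norm_sub_sq_real, inner_sub_right, Finset.sum_add_distrib,
        Finset.sum_sub_distrib, ← Finset.mul_sum]
      ring
    have l1 := (tendsto_finsetSum (Finset.univ : Finset I) fun i _ => hx i (xb i - xb' i)).add
      (tendsto_finsetSum (Finset.univ : Finset K) fun k _ => hv k (vb k - vb' k))
    have l2 := (tendsto_finsetSum (Finset.univ : Finset I) fun i _ => hx' i (xb i - xb' i)).add
      (tendsto_finsetSum (Finset.univ : Finset K) fun k _ => hv' k (vb k - vb' k))
    have q1 := tendsto_nhds_unique l1 (hℓ.mono_left hU)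
    have q2 := tendsto_nhds_unique l2 (hℓ.mono_left hV)
    have q3 : ∑ i, ‖xb i - xb' i‖ ^ 2 + ∑ k, ‖vb k - vb' k‖ ^ 2 = 0 := by
      have r1 : ∀ i, ‖xb i - xb' i‖ ^ 2 = ⟪xb i, xb i - xb' i⟫ - ⟪xb' i, xb i - xb' i⟫ :=
        fun i => by rw [← inner_sub_left, real_inner_self_eq_norm_sq]
      have r2 : ∀ k, ‖vb k - vb' k‖ ^ 2 = ⟪vb k, vb k - vb' k⟫ - ⟪vb' k, vb k - vb' k⟫ :=
        fun k => by rw [← inner_sub_left, real_inner_self_eq_norm_sq]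
      rw [Finset.sum_congr rfl fun i _ => r1 i, Finset.sum_congr rfl fun k _ => r2 k,
        Finset.sum_sub_distrib, Finset.sum_sub_distrib]
      linarith
    have n1 : 0 ≤ ∑ i, ‖xb i - xb' i‖ ^ 2 := by positivity
    have n2 : 0 ≤ ∑ k, ‖vb k - vb' k‖ ^ 2 := by positivity
    have z1 : ∑ i, ‖xb i - xb' i‖ ^ 2 = 0 := by linarith
    have z2 : ∑ k, ‖vb k - vb' k‖ ^ 2 = 0 := by linarith
    rw [Finset.sum_eq_zero_iff_of_nonneg (fun _ _ => sq_nonneg _)] at z1 z2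
    refine ⟨fun i => ?_, fun k => ?_⟩
    · have := z1 i (Finset.mem_univ i)
      rwa [sq_eq_zero_iff, norm_eq_zero, sub_eq_zero] at this
    · have := z2 k (Finset.mem_univ k)
      rwa [sq_eq_zero_iff, norm_eq_zero, sub_eq_zero] at this
  obtain ⟨xb, vb, hxw, hvw⟩ := hex (Ultrafilter.of atTop)
  have hof : ((Ultrafilter.of atTop : Ultrafilter ℕ) : Filter ℕ) ≤ atTop := Ultrafilter.of_le _
  refine ⟨xb, vb, hclus _ hof xb vb hxw hvw, fun i w => ?_, fun k w => ?_⟩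
  · rw [tendsto_iff_ultrafilter]
    intro V hV
    obtain ⟨xb', vb', hxw', hvw'⟩ := hex V
    rw [(hopial _ V hof hV xb xb' vb vb' hxw hvw hxw' hvw').1 i]
    exact hxw' i w
  · rw [tendsto_iff_ultrafilter]
    intro V hV
    obtain ⟨xb', vb', hxw', hvw'⟩ := hex V
    rw [(hopial _ V hof hV xb xb' vb vb' hxw hvw hxw' hvw').2 k]
    exact hvw' k w
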